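/- Every vertex of the complement graph of X(2e,K) has degree exactly (q^{4e-3} - q^{2e-2} - q + 1)/(q-1), and every vertex of X(2e,K) has degree exactly q^{4e-2} + q^{4e-3} - q^{2e-2}. Equivalently: for every fixed [a] ∈ V, the number of classes [b] ∈ V with [b] ≠ [a] and a M bᵀ = 0 equals (q^{4e-3} - q^{2e-2} - q + 1)/(q-1), and the number of classes [b] ∈ V with a M bᵀ ≠ 0 equals q^{4e-2} + q^{4e-3} - q^{2e-2}. -/

import Mathlib

open Matrix

/-- The symplectic form `a M bᵀ` where `M = [[0, Iₑ],[-Iₑ, 0]]`. -/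
def sympForm (K : Type) [CommRing K] (e : ℕ) (a b : Fin e ⊕ Fin e → K) : K :=
  a ⬝ᵥ ((Matrix.fromBlocks (0 : Matrix (Fin e) (Fin e) K) 1 (-1) 0) *ᵥ b)

/-- `V'`: the set of 2e-tuples over `K` having at least one unit entry. -/
def unitTuples (K : Type) [CommRing K] (e : ℕ) : Set (Fin e ⊕ Fin e → K) :=
  {a | ∃ i, IsUnit (a i)}

/-- The equivalence class `[a]` of a tuple under unit scaling. -/
def cls (K : Type) [CommRing K] (e : ℕ) (a : Fin e ⊕ Fin e → K) :
    Set (Fin e ⊕ Fin e → K) :=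
  {b | ∃ σ : Kˣ, b = σ • a}

/-- `V`: the set of equivalence classes of elements of `V'` under unit scaling. -/
def classes (K : Type) [CommRing K] (e : ℕ) : Set (Set (Fin e ⊕ Fin e → K)) :=
  {S | ∃ a ∈ unitTuples K e, S = cls K e a}

/-- Adjacency in the graph `X(2e,K)`: `a M bᵀ ∈ K \ {0}`. -/
def adjX (K : Type) [CommRing K] (e : ℕ) (A B : Set (Fin e ⊕ Fin e → K)) : Prop :=
  ∃ a ∈ A, ∃ b ∈ B, sympForm K e a b ≠ 0

/-- Adjacency in the complement of `X(2e,K)`: distinct classes with `a M bᵀ = 0`. -/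
def adjXc (K : Type) [CommRing K] (e : ℕ) (A B : Set (Fin e ⊕ Fin e → K)) : Prop :=
  A ≠ B ∧ ∃ a ∈ A, ∃ b ∈ B, sympForm K e a b = 0

/-- Adjacency in the graph `Y(2e,K)`: `a M bᵀ ∈ J \ {0}`. -/
def adjY (K : Type) [CommRing K] (J : Ideal K) (e : ℕ)
    (A B : Set (Fin e ⊕ Fin e → K)) : Prop :=
  ∃ a ∈ A, ∃ b ∈ B, sympForm K e a b ∈ J ∧ sympForm K e a b ≠ 0

/-- `T = J × ⋯ × J` (2e factors), as a subset of `K^{2e}`. -/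
def Tset (K : Type) [CommRing K] (J : Ideal K) (e : ℕ) : Set (Fin e ⊕ Fin e → K) :=
  {x | ∀ i, x i ∈ J}

/-- A hyperplane of `T`: a `K`-submodule contained in `T` of cardinality `q^(2e-1)`. -/
def IsHyperplane (K : Type) [CommRing K] (J : Ideal K) (e q : ℕ)
    (H : Submodule K (Fin e ⊕ Fin e → K)) : Prop :=
  (H : Set (Fin e ⊕ Fin e → K)) ⊆ Tset K J e ∧ Nat.card H = q ^ (2 * e - 1)

/-- `C(H,u) = {[u+h] : h ∈ H}`. -/
def classSet (K : Type) [CommRing K] (e : ℕ) (H : Submodule K (Fin e ⊕ Fin e → K))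
    (u : Fin e ⊕ Fin e → K) : Set (Set (Fin e ⊕ Fin e → K)) :=
  {S | ∃ h ∈ (H : Set (Fin e ⊕ Fin e → K)), S = cls K e (u + h)}

/-- The set of tuples `{σ • (u+h) : σ ∈ Kˣ, h ∈ H}`. -/
def orbitSet (K : Type) [CommRing K] (e : ℕ) (H : Submodule K (Fin e ⊕ Fin e → K))
    (u : Fin e ⊕ Fin e → K) : Set (Fin e ⊕ Fin e → K) :=
  {x | ∃ σ : Kˣ, ∃ h ∈ (H : Set (Fin e ⊕ Fin e → K)), x = σ • (u + h)}

/-- The coset `c • u + T` of `T`. -/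
def cosetOf (K : Type) [CommRing K] (J : Ideal K) (e : ℕ) (c : K)
    (u : Fin e ⊕ Fin e → K) : Set (Fin e ⊕ Fin e → K) :=
  {x | ∃ t ∈ Tset K J e, x = c • u + t}

section SympForm

variable {K : Type} [CommRing K] {e : ℕ}

theorem sympForm_eq_sum (a b : Fin e ⊕ Fin e → K) :
    sympForm K e a b =
      ∑ i, a (Sum.inl i) * b (Sum.inr i) - ∑ i, a (Sum.inr i) * b (Sum.inl i) := by
  simp [sympForm, dotProduct, Matrix.fromBlocks_mulVec, Fintype.sum_sum_type,
    Matrix.neg_mulVec, sub_eq_add_neg]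

theorem sympForm_add_right (a b c : Fin e ⊕ Fin e → K) :
    sympForm K e a (b + c) = sympForm K e a b + sympForm K e a c := by
  simp [sympForm, Matrix.mulVec_add, dotProduct_add]

theorem sympForm_smul_right (a b : Fin e ⊕ Fin e → K) (c : K) :
    sympForm K e a (c • b) = c * sympForm K e a b := by
  simp [sympForm, Matrix.mulVec_smul, dotProduct_smul]

theorem sympForm_smul_left (a b : Fin e ⊕ Fin e → K) (c : K) :
    sympForm K e (c • a) b = c * sympForm K e a b := by
  simp [sympForm, smul_dotProduct]

theorem sympForm_self (a : Fin e ⊕ Fin e → K) : sympForm K e a a = 0 := by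
  rw [sympForm_eq_sum, sub_eq_zero]
  exact Finset.sum_congr rfl fun i _ => mul_comm _ _

theorem sympForm_units_smul_smul_eq_zero_iff (σ τ : Kˣ) (a b : Fin e ⊕ Fin e → K) :
    sympForm K e (σ • a) (τ • b) = 0 ↔ sympForm K e a b = 0 := by
  simp only [Units.smul_def]
  rw [sympForm_smul_left, sympForm_smul_right]
  simp

theorem sympForm_mem (I : Ideal K) (a : Fin e ⊕ Fin e → K) {b : Fin e ⊕ Fin e → K}
    (hb : ∀ i, b i ∈ I) : sympForm K e a b ∈ I := by
  rw [sympForm_eq_sum]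
  exact I.sub_mem (I.sum_mem fun i _ => I.mul_mem_left _ (hb _))
    (I.sum_mem fun i _ => I.mul_mem_left _ (hb _))

theorem exists_sympForm_eq_one {a : Fin e ⊕ Fin e → K} (ha : a ∈ unitTuples K e) :
    ∃ v, sympForm K e a v = 1 := by
  obtain ⟨i | i, u, hu⟩ := ha
  · refine ⟨Pi.single (Sum.inr i) (↑u⁻¹ : K), ?_⟩
    simp [sympForm_eq_sum, Pi.single_apply, ← hu]
  · refine ⟨Pi.single (Sum.inl i) (-(↑u⁻¹ : K)), ?_⟩
    simp [sympForm_eq_sum, Pi.single_apply, ← hu]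

theorem card_Tset (I : Ideal K) : Nat.card (Tset K I e) = Nat.card I ^ (2 * e) := by
  have h : Nat.card (Tset K I e) = Nat.card (Fin e ⊕ Fin e → I) :=
    Nat.card_congr (Equiv.subtypePiEquivPi (p := fun _ x => x ∈ I))
  rw [h, Nat.card_fun]
  simp [two_mul]

theorem card_Tset_eq_mul_card_ker (I : Ideal K) {a : Fin e ⊕ Fin e → K}
    (ha : a ∈ unitTuples K e) :
    Nat.card (Tset K I e) =
      Nat.card I * Nat.card {b | b ∈ Tset K I e ∧ sympForm K e a b = 0} := by
  obtain ⟨v, hv⟩ := exists_sympForm_eq_one ha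
  rw [← Nat.card_prod]
  refine (Nat.card_congr ?_)
  refine
    { toFun := fun b => (⟨sympForm K e a b.1, sympForm_mem I a b.2⟩,
        ⟨b.1 + (-sympForm K e a b.1) • v, ?_, ?_⟩)
      invFun := fun p => ⟨(p.1 : K) • v + p.2.1, ?_⟩
      left_inv := ?_
      right_inv := ?_ }
  · intro i
    exact I.add_mem (b.2 i) (I.mul_mem_right _ (I.neg_mem (sympForm_mem I a b.2)))
  · rw [sympForm_add_right, sympForm_smul_right, hv]
    ring
  · intro i
    exact I.add_mem (I.mul_mem_right _ p.1.2) (p.2.2.1 i)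
  · intro b
    ext i
    simp
  · rintro ⟨⟨c, hc⟩, ⟨k, hk, hk0⟩⟩
    have h : sympForm K e a (c • v + k) = c := by
      rw [sympForm_add_right, sympForm_smul_right, hv, hk0]
      ring
    ext i
    · exact h
    · simp [h]

theorem mem_cls_self (a : Fin e ⊕ Fin e → K) : a ∈ cls K e a := ⟨1, (one_smul _ a).symm⟩

theorem cls_units_smul (σ : Kˣ) (a : Fin e ⊕ Fin e → K) : cls K e (σ • a) = cls K e a := by
  ext b
  constructor
  · rintro ⟨τ, rfl⟩
    exact ⟨τ * σ, (mul_smul _ _ _).symm⟩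
  · rintro ⟨τ, rfl⟩
    exact ⟨τ * σ⁻¹, by rw [← mul_smul, inv_mul_cancel_right]⟩

theorem units_smul_left_injective {a : Fin e ⊕ Fin e → K} (ha : a ∈ unitTuples K e) :
    Function.Injective fun σ : Kˣ => σ • a := by
  intro σ τ h
  obtain ⟨i, hi⟩ := ha
  have h' := congrFun h i
  simp only [Pi.smul_apply, Units.smul_def, smul_eq_mul] at h'
  exact Units.ext (hi.mul_right_cancel h')

/-- A set of tuples with a unit entry that is stable under unit scaling is a disjoint union of
classes, each of the size of the unit group. -/
theorem card_cls_image_mul_card_units {S : Set (Fin e ⊕ Fin e → K)} (hS : S ⊆ unitTuples K e)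
    (hsmul : ∀ (σ : Kˣ), ∀ b ∈ S, σ • b ∈ S) :
    Nat.card ↥(cls K e '' S) * Nat.card Kˣ = Nat.card S := by
  choose rep hrep hcls using fun B : ↥(cls K e '' S) => B.2
  rw [← Nat.card_prod]
  refine Nat.card_eq_of_bijective (fun p => ⟨p.2 • rep p.1, hsmul _ _ (hrep p.1)⟩) ⟨?_, ?_⟩
  · rintro ⟨B, σ⟩ ⟨C, τ⟩ h
    have h' : σ • rep B = τ • rep C := congrArg Subtype.val h
    have hBC : B = C := by
      apply Subtype.ext
      rw [← hcls B, ← hcls C, ← cls_units_smul σ, h', cls_units_smul]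
    subst hBC
    rw [units_smul_left_injective (hS (hrep B)) h']
  · rintro ⟨b, hb⟩
    have hb' : b ∈ cls K e (rep ⟨cls K e b, b, hb, rfl⟩) := by
      rw [hcls]
      exact mem_cls_self b
    obtain ⟨σ, hσ⟩ := hb'
    exact ⟨(⟨cls K e b, b, hb, rfl⟩, σ), Subtype.ext hσ.symm⟩

theorem units_smul_mem_unitTuples (σ : Kˣ) {b : Fin e ⊕ Fin e → K} (hb : b ∈ unitTuples K e) :
    σ • b ∈ unitTuples K e := by
  obtain ⟨i, hi⟩ := hb
  exact ⟨i, by simpa [Units.smul_def] using hi⟩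

theorem setOf_classes_adjX (a : Fin e ⊕ Fin e → K) :
    {B ∈ classes K e | adjX K e (cls K e a) B} =
      cls K e '' {b | b ∈ unitTuples K e ∧ sympForm K e a b ≠ 0} := by
  ext B
  constructor
  · rintro ⟨⟨b, hb, rfl⟩, _, ⟨σ, rfl⟩, _, ⟨τ, rfl⟩, h⟩
    exact ⟨b, ⟨hb, fun h0 => h ((sympForm_units_smul_smul_eq_zero_iff σ τ a b).2 h0)⟩, rfl⟩
  · rintro ⟨b, ⟨hb, h⟩, rfl⟩
    exact ⟨⟨b, hb, rfl⟩, a, mem_cls_self a, b, mem_cls_self b, h⟩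

theorem setOf_classes_adjXc (a : Fin e ⊕ Fin e → K) :
    {B ∈ classes K e | adjXc K e (cls K e a) B} =
      cls K e '' {b | b ∈ unitTuples K e ∧ sympForm K e a b = 0} \ {cls K e a} := by
  ext B
  constructor
  · rintro ⟨⟨b, hb, rfl⟩, hne, _, ⟨σ, rfl⟩, _, ⟨τ, rfl⟩, h⟩
    exact ⟨⟨b, ⟨hb, (sympForm_units_smul_smul_eq_zero_iff σ τ a b).1 h⟩, rfl⟩, hne.symm⟩
  · rintro ⟨⟨b, ⟨hb, h⟩, rfl⟩, hne⟩
    exact ⟨⟨b, hb, rfl⟩, Ne.symm hne, a, mem_cls_self a, b, mem_cls_self b, h⟩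

end SympForm

section UniqueIdeal

variable {K : Type} [CommRing K] {J : Ideal K}

theorem isUnit_iff_notMem_of_unique_ideal (hJtop : J ≠ ⊤)
    (hideals : ∀ I : Ideal K, I = ⊥ ∨ I = J ∨ I = ⊤) (x : K) : IsUnit x ↔ x ∉ J := by
  constructor
  · exact fun hx hxJ => hJtop (Ideal.eq_top_of_isUnit_mem J hxJ hx)
  · intro hx
    rcases hideals (Ideal.span {x}) with h | h | h
    · rw [Ideal.span_singleton_eq_bot] at h
      exact absurd (h ▸ J.zero_mem) hx
    · exact absurd (h ▸ Ideal.mem_span_singleton_self x) hx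
    · exact Ideal.span_singleton_eq_top.1 h

theorem card_ideal_eq_card_quotient [Finite K] (r : K) (hJr : J = Ideal.span {r})
    (hJbot : J ≠ ⊥) (hJtop : J ≠ ⊤)
    (hideals : ∀ I : Ideal K, I = ⊥ ∨ I = J ∨ I = ⊤) : Nat.card J = Nat.card (K ⧸ J) := by
  have hker : LinearMap.ker (LinearMap.toSpanSingleton K K r) = J := by
    rcases hideals (LinearMap.ker (LinearMap.toSpanSingleton K K r)) with h | h | h
    · have hsurj := Finite.surjective_of_injective (LinearMap.ker_eq_bot.1 h)
      obtain ⟨s, hs⟩ := hsurj 1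
      exact absurd (hJr.trans (Ideal.span_singleton_eq_top.2
        (IsUnit.of_mul_eq_one_right s (by simpa using hs)))) hJtop
    · exact h
    · have h1 : (1 : K) ∈ LinearMap.ker (LinearMap.toSpanSingleton K K r) := h ▸ trivial
      have hr : r = 0 := by simpa using h1
      exact absurd (by simpa [hr] using hJr) hJbot
  have hrange : LinearMap.range (LinearMap.toSpanSingleton K K r) = J := by
    rw [LinearMap.range_toSpanSingleton, hJr]
  have hcard := Nat.card_congr
    (LinearMap.quotKerEquivRange (LinearMap.toSpanSingleton K K r)).toEquiv
  rw [hrange, hker] at hcard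
  exact hcard.symm

theorem card_eq_card_quotient_sq [Finite K] (r : K) (hJr : J = Ideal.span {r})
    (hJbot : J ≠ ⊥) (hJtop : J ≠ ⊤)
    (hideals : ∀ I : Ideal K, I = ⊥ ∨ I = J ∨ I = ⊤) : Nat.card K = Nat.card (K ⧸ J) ^ 2 := by
  have h := Submodule.card_eq_card_quotient_mul_card J
  rw [card_ideal_eq_card_quotient r hJr hJbot hJtop hideals] at h
  rw [h, sq]

theorem card_units_add_card_ideal [Finite K] (hJtop : J ≠ ⊤)
    (hideals : ∀ I : Ideal K, I = ⊥ ∨ I = J ∨ I = ⊤) :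
    Nat.card Kˣ + Nat.card J = Nat.card K := by
  have h : Nat.card Kˣ = (J : Set K)ᶜ.ncard := by
    refine Nat.card_eq_of_bijective
      (fun u => (⟨u, (isUnit_iff_notMem_of_unique_ideal hJtop hideals _).1 u.isUnit⟩ :
        ↥(J : Set K)ᶜ)) ⟨?_, ?_⟩
    · exact fun u v huv => Units.ext (congrArg Subtype.val huv)
    · rintro ⟨x, hx⟩
      obtain ⟨u, rfl⟩ := (isUnit_iff_notMem_of_unique_ideal hJtop hideals x).2 hx
      exact ⟨u, rfl⟩
  rw [h, add_comm]
  exact Set.ncard_add_ncard_compl (J : Set K)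

theorem mem_unitTuples_iff_notMem_Tset {e : ℕ} (hJtop : J ≠ ⊤)
    (hideals : ∀ I : Ideal K, I = ⊥ ∨ I = J ∨ I = ⊤) (b : Fin e ⊕ Fin e → K) :
    b ∈ unitTuples K e ↔ b ∉ Tset K J e := by
  simp only [unitTuples, Tset, Set.mem_ofPred_eq, not_forall,
    isUnit_iff_notMem_of_unique_ideal hJtop hideals]

end UniqueIdeal

theorem degree_arithmetic {q f n₀ n₁ s₀ s₁ t z u : ℕ} (hq : 2 ≤ q) (hn₀ : n₀ ≠ 0)
    (hu : u + q = q ^ 2) (ht : q ^ (2 * (f + 2)) = q * t)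
    (hz : (q ^ 2) ^ (2 * (f + 2)) = q ^ 2 * z) (hst : s₀ + t = z)
    (hss : s₀ + s₁ + q ^ (2 * (f + 2)) = (q ^ 2) ^ (2 * (f + 2)))
    (h₀ : n₀ * u = s₀) (h₁ : n₁ * u = s₁) :
    n₀ - 1 = (q ^ (4 * f + 5) - q ^ (2 * f + 2) - q + 1) / (q - 1) ∧
      n₁ = q ^ (4 * f + 6) + q ^ (4 * f + 5) - q ^ (2 * f + 2) := by
  obtain ⟨p, rfl⟩ := Nat.exists_eq_add_of_le' (show 1 ≤ q by omega)
  obtain ⟨n, rfl⟩ := Nat.exists_eq_succ_of_ne_zero hn₀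
  have hp : 0 < p := by omega
  have e1 : (p + 1) ^ (2 * (f + 2)) = (p + 1) ^ (2 * f + 2) * (p + 1) ^ 2 := by ring
  have e2 : ((p + 1) ^ 2) ^ (2 * (f + 2)) = ((p + 1) ^ (2 * f + 2)) ^ 2 * (p + 1) ^ 4 := by
    simp only [← pow_mul, ← pow_add]
    congr 1
    ring
  have e3 : (p + 1) ^ (4 * f + 5) = ((p + 1) ^ (2 * f + 2)) ^ 2 * (p + 1) := by ring
  have e4 : (p + 1) ^ (4 * f + 6) = ((p + 1) ^ (2 * f + 2)) ^ 2 * (p + 1) ^ 2 := by ring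
  have hA : 2 ≤ (p + 1) ^ (2 * f + 2) := hq.trans (Nat.le_self_pow (by omega) _)
  rw [e1] at ht hss
  rw [e2] at hz hss
  rw [e3, e4, Nat.add_sub_cancel]
  generalize (p + 1) ^ (2 * f + 2) = A at *
  obtain rfl : u = (p + 1) * p := by nlinarith
  obtain rfl : t = A * (p + 1) :=
    Nat.eq_of_mul_eq_mul_left p.succ_pos (by rw [Nat.succ_eq_add_one]; linarith)
  obtain rfl : z = A ^ 2 * (p + 1) ^ 2 :=
    Nat.eq_of_mul_eq_mul_left (pow_pos p.succ_pos 2) (by rw [Nat.succ_eq_add_one]; linarith)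
  subst h₀ h₁
  have k₀ : (n + 1) * p + A = A ^ 2 * (p + 1) :=
    Nat.eq_of_mul_eq_mul_left p.succ_pos (by rw [Nat.succ_eq_add_one] at *; linarith)
  have k₁ : n₁ + A = A ^ 2 * (p + 1) ^ 2 + A ^ 2 * (p + 1) := by
    refine Nat.eq_of_mul_eq_mul_left (Nat.mul_pos p.succ_pos hp) ?_
    rw [Nat.succ_eq_add_one] at *
    zify at *
    linear_combination hss - hst
  refine ⟨?_, by omega⟩
  have k₂ : A ^ 2 * (p + 1) - A - (p + 1) + 1 = n * p := by
    have k₃ : (n + 1) * p = n * p + p := by ring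
    have k₄ : 0 < n * p := by
      by_contra h
      have h' : n * p = 0 := by omega
      nlinarith [Nat.mul_le_mul hA (Nat.le_refl (A * (p + 1))), Nat.mul_le_mul_right p hA]
    omega
  rw [k₂, Nat.mul_div_cancel _ hp, Nat.succ_eq_add_one, Nat.add_sub_cancel]

/-- Proposition: the complement of `X(2e,K)` is regular of degree
`(q^(4e-3) - q^(2e-2) - q + 1)/(q-1)` and `X(2e,K)` is regular of degree
`q^(4e-2) + q^(4e-3) - q^(2e-2)`. -/
theorem degree_X_and_complement
    (K : Type) [CommRing K] [Fintype K]
    (J : Ideal K) (r : K) (q : ℕ)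
    (hJr : J = Ideal.span {r})
    (hJbot : J ≠ ⊥) (hJtop : J ≠ ⊤)
    (hideals : ∀ I : Ideal K, I = ⊥ ∨ I = J ∨ I = ⊤)
    (hq : IsPrimePow q)
    (hqcard : Nat.card (K ⧸ J) = q)
    (e : ℕ) (he : 2 ≤ e) :
    ∀ a ∈ unitTuples K e,
      Nat.card ↥{B ∈ classes K e | adjXc K e (cls K e a) B} =
        (q ^ (4 * e - 3) - q ^ (2 * e - 2) - q + 1) / (q - 1) ∧
      Nat.card ↥{B ∈ classes K e | adjX K e (cls K e a) B} =
        q ^ (4 * e - 2) + q ^ (4 * e - 3) - q ^ (2 * e - 2) := by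
  intro a ha
  have hq2 : 2 ≤ q := hq.two_le
  have hJ : Nat.card J = q := by
    rw [card_ideal_eq_card_quotient r hJr hJbot hJtop hideals, hqcard]
  have hK : Nat.card K = q ^ 2 := by
    rw [card_eq_card_quotient_sq r hJr hJbot hJtop hideals, hqcard]
  have hU : Nat.card Kˣ + q = q ^ 2 := by
    rw [← hK, ← card_units_add_card_ideal hJtop hideals, hJ]
  have hmem := mem_unitTuples_iff_notMem_Tset (e := e) hJtop hideals
  set S₀ := {b | b ∈ unitTuples K e ∧ sympForm K e a b = 0} with hS₀
  set S₁ := {b | b ∈ unitTuples K e ∧ sympForm K e a b ≠ 0} with hS₁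
  set T₀ := {b | b ∈ Tset K J e ∧ sympForm K e a b = 0} with hT₀
  set Z := {b | b ∈ Tset K (⊤ : Ideal K) e ∧ sympForm K e a b = 0} with hZ
  have hTtop : Tset K (⊤ : Ideal K) e = Set.univ := by ext; simp [Tset]
  have htop : Nat.card (⊤ : Ideal K) = q ^ 2 := by
    rw [← hK]
    exact Nat.card_congr (Equiv.Set.univ K)
  have cT : q ^ (2 * e) = q * Nat.card T₀ := by
    rw [← hJ, ← card_Tset, hT₀, ← card_Tset_eq_mul_card_ker J ha]
  have cZ : (q ^ 2) ^ (2 * e) = q ^ 2 * Nat.card Z := by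
    rw [← htop, ← card_Tset, hZ, ← card_Tset_eq_mul_card_ker ⊤ ha]
  have split₀ : Nat.card S₀ + Nat.card T₀ = Nat.card Z := by
    have hd : Disjoint S₀ T₀ :=
      Set.disjoint_left.2 fun b hb hb' => (hmem b).1 hb.1 hb'.1
    have hu : S₀ ∪ T₀ = Z := by
      ext b
      simp only [hS₀, hT₀, hZ, hTtop, Set.mem_union, Set.mem_ofPred_eq, Set.mem_univ, hmem]
      tauto
    rw [← hu]
    exact (Set.ncard_union_eq hd).symm
  have split₁ : Nat.card S₀ + Nat.card S₁ + q ^ (2 * e) = (q ^ 2) ^ (2 * e) := by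
    have hd : Disjoint S₀ S₁ := Set.disjoint_left.2 fun b hb hb' => hb'.2 hb.2
    have hu : S₀ ∪ S₁ = (Tset K J e)ᶜ := by
      ext b
      simp only [hS₀, hS₁, Set.mem_union, Set.mem_ofPred_eq, Set.mem_compl_iff, hmem]
      tauto
    have h1 : Nat.card S₀ + Nat.card S₁ = (Tset K J e)ᶜ.ncard := by
      rw [← hu]
      exact (Set.ncard_union_eq hd).symm
    have h2 : (Tset K J e).ncard = q ^ (2 * e) := by
      rw [← hJ, ← card_Tset]
      rfl
    have h3 := Set.ncard_add_ncard_compl (Tset K J e)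
    have h4 : Nat.card (Fin e ⊕ Fin e → K) = (q ^ 2) ^ (2 * e) := by
      rw [Nat.card_fun, hK]
      simp [two_mul]
    omega
  have c₀ : Nat.card ↥(cls K e '' S₀) * Nat.card Kˣ = Nat.card S₀ :=
    card_cls_image_mul_card_units (fun b hb => hb.1) fun σ b hb =>
      ⟨units_smul_mem_unitTuples σ hb.1, by
        simpa using (sympForm_units_smul_smul_eq_zero_iff 1 σ a b).2 hb.2⟩
  have c₁ : Nat.card ↥(cls K e '' S₁) * Nat.card Kˣ = Nat.card S₁ :=
    card_cls_image_mul_card_units (fun b hb => hb.1) fun σ b hb =>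
      ⟨units_smul_mem_unitTuples σ hb.1, fun h => hb.2
        ((sympForm_units_smul_smul_eq_zero_iff 1 σ a b).1 (by simpa using h))⟩
  have cdiff : Nat.card ↥(cls K e '' S₀ \ {cls K e a}) = Nat.card ↥(cls K e '' S₀) - 1 :=
    Set.ncard_sdiff_singleton_of_mem ⟨a, ⟨ha, sympForm_self a⟩, rfl⟩
  rw [setOf_classes_adjX, setOf_classes_adjXc, ← hS₀, ← hS₁, cdiff]
  have hn₀ : Nat.card ↥(cls K e '' S₀) ≠ 0 :=
    Nat.card_ne_zero.2 ⟨⟨_, a, ⟨ha, sympForm_self a⟩, rfl⟩, inferInstance⟩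
  obtain ⟨f, rfl⟩ := Nat.exists_eq_add_of_le' he
  rw [show 4 * (f + 2) - 3 = 4 * f + 5 by omega, show 2 * (f + 2) - 2 = 2 * f + 2 by omega,
    show 4 * (f + 2) - 2 = 4 * f + 6 by omega]
  exact degree_arithmetic hq2 hn₀ hU cT cZ split₀ split₁ c₀ c₁
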